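/- There do not exist five points m₁,…,m₅ in ℝ³ which are not coplanar and of which no three are collinear, such that for every pair of indices i ≠ j there exist a line L and a radius r > 0 with the property that all five points lie on the cylinder of revolution with axis L and radius r and the line through mᵢ and mⱼ is a ruling of this cylinder. -/

import Mathlib

open Metric

noncomputable section

local notation "E3" => EuclideanSpace ℝ (Fin 3)

/-- A line in `ℝ³` is a one-dimensional affine subspace. -/
def IsLine (L : AffineSubspace ℝ (EuclideanSpace ℝ (Fin 3))) : Prop :=
  Module.finrank ℝ L.direction = 1

/-- The cylinder of revolution with axis `L` and radius `r`. -/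
def Cylinder (L : AffineSubspace ℝ (EuclideanSpace ℝ (Fin 3))) (r : ℝ) :
    Set (EuclideanSpace ℝ (Fin 3)) :=
  {x | Metric.infDist x (L : Set (EuclideanSpace ℝ (Fin 3))) = r}

theorem infDist_line_sq (L : AffineSubspace ℝ E3) (h : IsLine L) :
    ∃ a u : E3, ∀ x : E3,
      ‖u‖ = 1 ∧ (infDist x (L : Set E3)) ^ 2 = ‖x - a‖ ^ 2 - (inner ℝ u (x - a)) ^ 2 := by
  have hne : (L : Set E3).Nonempty := by
    rw [Set.nonempty_iff_ne_empty]
    intro h0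
    have : L = ⊥ := by
      rwa [AffineSubspace.coe_eq_bot_iff] at h0
    subst this
    rw [IsLine, AffineSubspace.direction_bot, finrank_bot] at h
    omega
  obtain ⟨a, ha⟩ := hne
  obtain ⟨u0, hu0, hspan⟩ := finrank_eq_one_iff'.1 h
  have hn : ‖(u0 : E3)‖ ≠ 0 := by simpa using hu0
  have hu1 : ‖(‖(u0 : E3)‖⁻¹ • (u0 : E3))‖ = 1 := by
    rw [norm_smul, norm_inv, norm_norm, inv_mul_cancel₀ hn]
  have hud : (‖(u0 : E3)‖⁻¹ • (u0 : E3)) ∈ L.direction := L.direction.smul_mem _ u0.2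
  have hgen : ∀ w ∈ L.direction, ∃ c : ℝ, w = c • (‖(u0 : E3)‖⁻¹ • (u0 : E3)) := by
    intro w hw
    obtain ⟨c, hc⟩ := hspan ⟨w, hw⟩
    refine ⟨c * ‖(u0 : E3)‖, ?_⟩
    have : c • (u0 : E3) = w := by simpa using congrArg Subtype.val hc
    rw [smul_smul, mul_assoc, mul_inv_cancel₀ hn, mul_one, this]
  generalize (‖(u0 : E3)‖⁻¹ • (u0 : E3)) = u at hu1 hud hgen
  refine ⟨a, u, fun x => ⟨hu1, ?_⟩⟩
  have huu : inner ℝ u u = (1 : ℝ) := by rw [real_inner_self_eq_norm_sq, hu1]; norm_num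
  have key : ∀ c : ℝ, dist x (c • u + a) ^ 2
      = ‖x - a‖ ^ 2 - (inner ℝ u (x - a)) ^ 2 + (c - inner ℝ u (x - a)) ^ 2 := by
    intro c
    have e : x - (c • u + a) = (x - a) - c • u := by abel
    rw [dist_eq_norm, e, norm_sub_sq_real, norm_smul, hu1, inner_smul_right,
      real_inner_comm, mul_one, Real.norm_eq_abs, sq_abs]
    ring
  have hmem : ∀ c : ℝ, c • u + a ∈ L := fun c =>
    AffineSubspace.vadd_mem_of_mem_direction (L.direction.smul_mem c hud) ha
  have hnonneg : 0 ≤ ‖x - a‖ ^ 2 - (inner ℝ u (x - a)) ^ 2 := by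
    have := key (inner ℝ u (x - a))
    nlinarith [sq_nonneg (dist x ((inner ℝ u (x - a) : ℝ) • u + a))]
  have hle : infDist x (L : Set E3) ≤ dist x ((inner ℝ u (x - a) : ℝ) • u + a) :=
    infDist_le_dist_of_mem (hmem _)
  have hge : dist x ((inner ℝ u (x - a) : ℝ) • u + a) ≤ infDist x (L : Set E3) := by
    refine (le_infDist ⟨a, ha⟩).2 ?_
    intro y hy
    obtain ⟨c, hc⟩ := hgen (y - a) (AffineSubspace.vsub_mem_direction hy ha)
    have hy' : y = c • u + a := by rw [← hc]; abel
    rw [hy']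
    refine (sq_le_sq₀ dist_nonneg dist_nonneg).1 ?_
    rw [key, key]
    nlinarith [sq_nonneg (c - inner ℝ u (x - a))]
  rw [le_antisymm hle hge, key]
  ring

theorem cyl_eq (L : AffineSubspace ℝ E3) (r : ℝ) (h : IsLine L) (p q : E3)
    (hr : (affineSpan ℝ ({p, q} : Set E3) : Set E3) ⊆ Cylinder L r) :
    ∃ a : E3, ∀ x ∈ Cylinder L r,
      ‖x - a‖ ^ 2 * ‖q - p‖ ^ 2 - (inner ℝ (q - p) (x - a)) ^ 2 = r ^ 2 * ‖q - p‖ ^ 2 := by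
  obtain ⟨a, u, hu⟩ := infDist_line_sq L h
  have hu1 := (hu 0).1
  have hC : ∀ x ∈ Cylinder L r, ‖x - a‖ ^ 2 - (inner ℝ u (x - a)) ^ 2 = r ^ 2 := by
    intro x hx
    rw [← (hu x).2, show infDist x (L : Set E3) = r from hx]
  have hline : ∀ t : ℝ, ‖(p - a) + t • (q - p)‖ ^ 2
      - (inner ℝ u ((p - a) + t • (q - p))) ^ 2 = r ^ 2 := by
    intro t
    have := hC _ (hr (AffineMap.lineMap_mem_affineSpan_pair t p q))
    rw [AffineMap.lineMap_apply] at this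
    have e : (t • (q -ᵥ p) +ᵥ p) - a = (p - a) + t • (q - p) := by
      simp only [vsub_eq_sub, vadd_eq_add]; abel
    rwa [e] at this
  generalize q - p = v at *
  have h0 := hline 0
  have h1 := hline 1
  have h2 := hline (-1)
  simp only [norm_add_sq_real, inner_add_right, inner_smul_right, norm_smul, norm_neg, norm_one,
    norm_zero] at h0 h1 h2
  have hv : ‖v‖ ^ 2 = (inner ℝ u v) ^ 2 := by nlinarith
  have hvu : v - (inner ℝ u v : ℝ) • u = 0 := by
    rw [← norm_eq_zero, ← sq_eq_zero_iff, norm_sub_sq_real, norm_smul, hu1, inner_smul_right,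
      real_inner_comm u v, mul_one, Real.norm_eq_abs, sq_abs, hv]
    ring
  refine ⟨a, fun x hx => ?_⟩
  have e : inner ℝ v (x - a) = (inner ℝ u v : ℝ) * inner ℝ u (x - a) := by
    conv_lhs => rw [sub_eq_zero.1 hvu]
    rw [inner_smul_left]; simp
  rw [e, ← hC x hx, hv]
  ring

theorem main_alg (w : Fin 4 → E3) (hspan : Submodule.span ℝ (Set.range w) = ⊤)
    (hinj : Function.Injective w) (hne : ∀ i, w i ≠ 0)
    (hB : ∀ μ : Fin 4 → ℝ, ∑ i, μ i • w i = 0 → ∀ v, (∃ i, v = w i) ∨ (∃ i j, v = w i - w j) →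
      ∑ i, μ i * (inner ℝ (w i) v) ^ 2 = (∑ i, μ i * ‖w i‖ ^ 2) * ‖v‖ ^ 2) : False := by
  have hker : Module.finrank ℝ (LinearMap.ker (Fintype.linearCombination ℝ w)) = 1 := by
    have h1 := LinearMap.finrank_range_add_finrank_ker (Fintype.linearCombination ℝ w)
    rw [Fintype.range_linearCombination, hspan] at h1
    simp at h1
    omega
  obtain ⟨⟨μ, hμ⟩, hμ0, hgen⟩ := finrank_eq_one_iff'.1 hker
  have hrel : ∑ i, μ i • w i = 0 := by
    simpa [Fintype.linearCombination_apply] using hμ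
  have hμ0' : μ ≠ 0 := fun h => hμ0 (by ext1; exact h)
  have hB := hB μ hrel
  obtain ⟨S, hS⟩ : ∃ S, S = ∑ i, μ i * ‖w i‖ ^ 2 := ⟨_, rfl⟩
  rw [← hS] at hB
  -- the vector-valued operator
  let A : E3 →ₗ[ℝ] E3 := ∑ i, μ i • ((innerₗ E3 (w i)).smulRight (w i)) - S • LinearMap.id
  have hA : ∀ x, A x = ∑ i, (μ i * inner ℝ (w i) x) • w i - S • x := by
    intro x; simp [A, LinearMap.sum_apply, smul_smul]
  have hAi : ∀ x y, inner ℝ (A x) y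
      = ∑ i, μ i * inner ℝ (w i) x * inner ℝ (w i) y - S * inner ℝ x y := by
    intro x y
    rw [hA, inner_sub_left, sum_inner]
    simp [inner_smul_left]
  have hq : ∀ v, (∃ i, v = w i) ∨ (∃ i j, v = w i - w j) → inner ℝ (A v) v = (0 : ℝ) := by
    intro v hv
    rw [hAi, real_inner_self_eq_norm_sq, ← hB v hv]
    simp only [← Finset.sum_sub_distrib]
    exact Finset.sum_eq_zero fun i _ => by ring
  have hsymm : ∀ x y, inner ℝ (A x) y = inner ℝ (A y) x := by
    intro x y
    rw [hAi, hAi, real_inner_comm x y]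
    congr 1
    exact Finset.sum_congr rfl fun i _ => by ring
  have hij : ∀ i j, inner ℝ (A (w i)) (w j) = 0 := by
    intro i j
    have h1 := hq _ (Or.inl ⟨i, rfl⟩)
    have h2 := hq _ (Or.inl ⟨j, rfl⟩)
    have h3 := hq _ (Or.inr ⟨i, j, rfl⟩)
    rw [map_sub, inner_sub_left, inner_sub_right, inner_sub_right, h1, h2, hsymm (w j)] at h3
    linarith
  have hAw : ∀ i, A (w i) = 0 := by
    intro i
    have : innerₗ E3 (A (w i)) = 0 := by
      refine LinearMap.ext_on_range hspan fun j => ?_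
      simpa using hij i j
    have h := congrArg (fun f => f (A (w i))) this
    simpa using h
  have hA0 : A = 0 := LinearMap.ext_on_range hspan (by simpa using hAw)
  have hS0 : S = 0 := by
    have hh : ∀ k : Fin 3, ∑ i, μ i * (w i k) ^ 2 - S = 0 := by
      intro k
      have := hAi (EuclideanSpace.single k 1) (EuclideanSpace.single k 1)
      rw [hA0] at this
      simp [EuclideanSpace.inner_single_right] at this
      rw [this]
      congr 1
      exact Finset.sum_congr rfl fun i _ => by ring
    have hs : S = ∑ k : Fin 3, ∑ i, μ i * (w i k) ^ 2 := by
      rw [hS, Finset.sum_comm]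
      refine Finset.sum_congr rfl fun i _ => ?_
      rw [EuclideanSpace.norm_sq_eq, Finset.mul_sum]
      simp
    rw [Fin.sum_univ_three] at hs
    linarith [hh 0, hh 1, hh 2]
  have hx : ∀ x, ∃ t : ℝ, ∀ i, t * μ i = μ i * inner ℝ (w i) x := by
    intro x
    have h1 : ∑ i, (μ i * inner ℝ (w i) x) • w i = 0 := by
      have := hA x
      rw [hA0, hS0] at this
      simpa using this.symm
    obtain ⟨t, ht⟩ := hgen ⟨fun i => μ i * inner ℝ (w i) x, by
      simpa [Fintype.linearCombination_apply] using h1⟩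
    refine ⟨t, fun i => ?_⟩
    have := congrArg (fun f => f.1 i) ht
    simpa using this
  obtain ⟨i, hi⟩ := Function.ne_iff.1 hμ0'
  have hi : μ i ≠ 0 := hi
  have hz : ∀ j, j ≠ i → μ j = 0 := by
    intro j hji
    by_contra hj
    refine hji (hinj (ext_inner_right ℝ fun x => ?_))
    obtain ⟨t, ht⟩ := hx x
    have h1 := ht i
    have h2 := ht j
    rw [mul_comm] at h1 h2
    rw [← mul_left_cancel₀ hi h1, ← mul_left_cancel₀ hj h2]
  have hwi : w i = 0 := by
    rw [Finset.sum_eq_single i (fun j _ hj => by rw [hz j hj, zero_smul]) (by simp)] at hrel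
    exact (smul_eq_zero.1 hrel).resolve_left hi
  exact hne i hwi

/-- There do not exist five non-coplanar points of `ℝ³`, no three of which are
collinear, such that for every pair of indices `i ≠ j` the five points lie on a
cylinder of revolution having the line through `mᵢ` and `mⱼ` as a ruling. -/
theorem no_five_points_all_lines_rulings :
    ¬ ∃ m : Fin 5 → E3,
      (¬ Coplanar ℝ (Set.range m)) ∧
      (∀ i j k : Fin 5, i ≠ j → i ≠ k → j ≠ k →
        ¬ Collinear ℝ ({m i, m j, m k} : Set E3)) ∧
      (∀ i j : Fin 5, i ≠ j →
        ∃ (L : AffineSubspace ℝ E3) (r : ℝ), IsLine L ∧ 0 < r ∧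
          (∀ k : Fin 5, m k ∈ Cylinder L r) ∧
          (affineSpan ℝ ({m i, m j} : Set E3) : Set E3) ⊆ Cylinder L r) := by
  rintro ⟨m, hcop, hcol, hcyl⟩
  have hinj : Function.Injective m := by
    intro i j hij
    by_contra hne
    obtain ⟨k, hk1, hk2⟩ : ∃ k : Fin 5, i ≠ k ∧ j ≠ k := by
      clear hcol hcyl hij hne hcop
      revert i j
      decide
    refine hcol i j k hne hk1 hk2 ?_
    rw [hij, Set.insert_eq_of_mem (Set.mem_insert _ _)]
    exact collinear_pair ℝ _ _
  have hspan : Submodule.span ℝ (Set.range fun i : Fin 4 => m i.succ - m 0) = ⊤ := by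
    apply Submodule.eq_top_of_finrank_eq
    rw [finrank_euclideanSpace_fin]
    have e : vectorSpan ℝ (Set.range m)
        = Submodule.span ℝ (Set.range fun i : Fin 4 => m i.succ - m 0) := by
      rw [vectorSpan_range_eq_span_range_vsub_right ℝ m 0]
      apply le_antisymm
      · rw [Submodule.span_le]
        rintro _ ⟨i, rfl⟩
        refine Fin.cases ?_ (fun i => ?_) i
        · simp
        · exact Submodule.subset_span ⟨i, rfl⟩
      · refine Submodule.span_mono ?_
        rintro _ ⟨i, rfl⟩
        exact ⟨i.succ, rfl⟩
    rw [← e]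
    have h1 : ¬ Module.finrank ℝ (vectorSpan ℝ (Set.range m)) ≤ 2 := by
      intro h
      exact hcop (coplanar_iff_finrank_le_two.2 h)
    have h2 := Submodule.finrank_le (vectorSpan ℝ (Set.range m))
    rw [finrank_euclideanSpace_fin] at h2
    omega
  refine main_alg _ hspan ?_ ?_ ?_
  · intro i j hij
    exact Fin.succ_injective _ (hinj (sub_left_injective hij))
  · intro i h
    exact Fin.succ_ne_zero i (hinj (sub_eq_zero.1 h))
  · intro μ hrel v hv
    have hv' : v = 0 ∨ ∃ i j : Fin 5, i ≠ j ∧ v = m j - m i := by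
      rcases hv with ⟨i, rfl⟩ | ⟨i, j, rfl⟩
      · exact Or.inr ⟨0, i.succ, (Fin.succ_ne_zero i).symm, rfl⟩
      · by_cases hij : i = j
        · left; simp [hij]
        · refine Or.inr ⟨j.succ, i.succ, fun h => hij (Fin.succ_injective _ h).symm, ?_⟩
          abel
    rcases hv' with rfl | ⟨i, j, hij, rfl⟩
    · simp
    obtain ⟨L, r, hL, -, hk, hr⟩ := hcyl i j hij
    obtain ⟨a, ha⟩ := cyl_eq L r hL _ _ hr
    generalize m j - m i = v at ha
    have h0 := ha _ (hk 0)
    have hw : ∀ k : Fin 4, ‖m k.succ - m 0‖ ^ 2 * ‖v‖ ^ 2 - (inner ℝ (m k.succ - m 0) v) ^ 2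
        = inner ℝ (m k.succ - m 0) ((2 * inner ℝ v (m 0 - a)) • v
          - (2 * ‖v‖ ^ 2) • (m 0 - a)) := by
      intro k
      have h1 := ha _ (hk k.succ)
      have e : m k.succ - a = (m k.succ - m 0) + (m 0 - a) := by abel
      rw [e] at h1
      generalize m k.succ - m 0 = w at *
      generalize m 0 - a = b at *
      rw [norm_add_sq_real, inner_add_right] at h1
      rw [inner_sub_right, inner_smul_right, inner_smul_right, real_inner_comm v w]
      linear_combination h1 - h0
    generalize ((2 * inner ℝ v (m 0 - a)) • v - (2 * ‖v‖ ^ 2) • (m 0 - a)) = z at hw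
    have hz : ∑ k : Fin 4, μ k * inner ℝ (m k.succ - m 0) z = 0 := by
      have := congrArg (fun y => inner ℝ y z) hrel
      simpa only [sum_inner, real_inner_smul_left, inner_zero_left] using this
    simp only [← hw, mul_sub, Finset.sum_sub_distrib] at hz
    rw [Finset.sum_mul]
    simp only [mul_assoc]
    linarith

end
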